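/- arXiv:1609.01264 — 2 statements merged into one kernel-verified Lean document; each statement's English description precedes it below -/
import Mathlib

section
/- Let D = D_h be a balanced domain in ℂ^n (h upper semicontinuous, absolutely homogeneous, h ≢ 0). Then h_BK^* ≤ h on ℂ^n, and every function f ∈ L²_h(D_h) extends holomorphically to the balanced domain D_{h_BK^*} = {z ∈ ℂ^n : h_BK^*(z) < 1}; i.e., for every f ∈ L²_h(D_h) there exists F holomorphic on {h_BK^* < 1} with F = f on D_h. -/
open MeasureTheory Filter Topology
open scoped ENNReal NNReal

noncomputable section

/-- `f` belongs to the Bergman space `L²_h(D)`: holomorphic on `D` and square integrable. -/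
def MemL2h {n : ℕ} (D : Set (Fin n → ℂ)) (f : (Fin n → ℂ) → ℂ) : Prop :=
  DifferentiableOn ℂ f D ∧ (∫⁻ z in D, (‖f z‖₊ : ℝ≥0∞) ^ 2) < ⊤

/-- `h` is absolutely homogeneous. -/
def AbsHomog {n : ℕ} (h : (Fin n → ℂ) → ℝ) : Prop :=
  ∀ (c : ℂ) (z : Fin n → ℂ), h (c • z) = ‖c‖ * h z

/-- `log h` is plurisubharmonic (sub-mean value inequality on complex lines, where the
possibly `-∞`-valued integrand is handled via truncations `max · c`). -/
def LogPSH {n : ℕ} (h : (Fin n → ℂ) → ℝ) : Prop :=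
  ∀ (a b : Fin n → ℂ) (r : ℝ), 0 < r → h a ≠ 0 → ∀ c : ℝ,
    Real.log (h a) ≤ (1 / (2 * Real.pi)) *
      ∫ θ in (0:ℝ)..(2 * Real.pi),
        max (Real.log (h (a + ((r : ℂ) * Complex.exp (θ * Complex.I)) • b))) c

/-- `M_d(z)`: sup of `|P(z)|` over homogeneous polynomials `P` of degree `d` with
`∫_{D_h} |P|² dλ ≤ 1`. -/
def Md {n : ℕ} (h : (Fin n → ℂ) → ℝ) (d : ℕ) (z : Fin n → ℂ) : ℝ≥0∞ :=
  ⨆ (P : MvPolynomial (Fin n) ℂ) (_ : P.IsHomogeneous d)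
    (_ : (∫⁻ w in {w | h w < 1}, (‖MvPolynomial.eval w P‖₊ : ℝ≥0∞) ^ 2) ≤ 1),
    (‖MvPolynomial.eval z P‖₊ : ℝ≥0∞)

/-- `h_BK(z) = limsup_{d → ∞} M_d(z)^{1/d}`. -/
def hBK {n : ℕ} (h : (Fin n → ℂ) → ℝ) (z : Fin n → ℂ) : ℝ≥0∞ :=
  Filter.limsup (fun d : ℕ => (Md h d z) ^ (1 / (d : ℝ))) atTop

/-- Upper semicontinuous regularization of `h_BK`. -/
def hBKstar {n : ℕ} (h : (Fin n → ℂ) → ℝ) (z : Fin n → ℂ) : ℝ≥0∞ :=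
  Filter.limsup (hBK h) (𝓝 z)

/-- The Bergman kernel of `D` on the diagonal. -/
def bergmanK {n : ℕ} (D : Set (Fin n → ℂ)) (z : Fin n → ℂ) : ℝ≥0∞ :=
  ⨆ (f : (Fin n → ℂ) → ℂ) (_ : DifferentiableOn ℂ f D)
    (_ : (∫⁻ w in D, (‖f w‖₊ : ℝ≥0∞) ^ 2) ≤ 1), (‖f z‖₊ : ℝ≥0∞) ^ 2

/-- `D` is an `L²_h`-domain of holomorphy. -/
def IsL2hDomainOfHolomorphy {n : ℕ} (D : Set (Fin n → ℂ)) : Prop :=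
  ¬ ∃ D₀ D₁ : Set (Fin n → ℂ), IsOpen D₀ ∧ IsOpen D₁ ∧ IsConnected D₀ ∧ IsConnected D₁ ∧
      D₀ ⊆ D₁ ∩ D ∧ ¬ (D₁ ⊆ D) ∧
      ∀ f : (Fin n → ℂ) → ℂ, MemL2h D f →
        ∃ F : (Fin n → ℂ) → ℂ, DifferentiableOn ℂ F D₁ ∧ Set.EqOn F f D₀

/-- The Lelong number `ν(log h, [v])` of `log h` at the direction `[v] ∈ ℙ¹`. -/
def lelong (h : (Fin 2 → ℂ) → ℝ) (v : Fin 2 → ℂ) : ℝ :=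
  if v 1 ≠ 0 then
    Filter.limsup (fun r : ℝ =>
      (⨆ θ : ℝ, Real.log (h ![v 0 + (r : ℂ) * Complex.exp (θ * Complex.I), v 1])) / Real.log r)
      (𝓝[>] 0)
  else
    Filter.limsup (fun r : ℝ =>
      (⨆ θ : ℝ, Real.log (h ![v 0, (r : ℂ) * Complex.exp (θ * Complex.I)])) / Real.log r)
      (𝓝[>] 0)

/-- `m(Q,[v])`: the largest `k` such that `(v₂ z₁ - v₁ z₂)^k` divides `Q`. -/
def multAt (v : Fin 2 → ℂ) (Q : MvPolynomial (Fin 2) ℂ) : ℕ :=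
  sSup {k : ℕ |
    (MvPolynomial.C (v 1) * MvPolynomial.X 0 - MvPolynomial.C (v 0) * MvPolynomial.X 1) ^ k ∣ Q}

/-! ### Averages over the rotations `v ↦ exp (iθ) v` -/

theorem measurePreserving_exp_smul {n : ℕ} (θ : ℝ) :
    MeasurePreserving (fun v : Fin n → ℂ => Complex.exp (θ * Complex.I) • v) := by
  refine volume_preserving_pi (f := fun _ z => Complex.exp (θ * Complex.I) * z) fun _ => ?_
  exact (rotation (Circle.exp θ)).measurePreserving

theorem lintegral_lintegral_exp_smul {n : ℕ} {φ : (Fin n → ℂ) → ℝ≥0∞} (hφ : Measurable φ) :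
    ∫⁻ v, ∫⁻ θ in Set.Ioc 0 (2 * Real.pi), φ (Complex.exp (θ * Complex.I) • v) =
      ENNReal.ofReal (2 * Real.pi) * ∫⁻ v, φ v := by
  rw [lintegral_lintegral_swap]
  · have h : ∀ θ : ℝ, ∫⁻ v, φ (Complex.exp (θ * Complex.I) • v) = ∫⁻ v, φ v := fun θ =>
      (measurePreserving_exp_smul θ).lintegral_comp hφ
    simp only [h, lintegral_const, Measure.restrict_apply_univ, Real.volume_Ioc, sub_zero,
      mul_comm (ENNReal.ofReal _)]
  · refine (hφ.comp ?_).aemeasurable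
    have : Continuous fun p : (Fin n → ℂ) × ℝ => Complex.exp (p.2 * Complex.I) • p.1 := by
      fun_prop
    exact this.measurable

/-- A function with the sub-mean value property on circles has it on balls. -/
theorem mul_volume_ball_le_lintegral {n : ℕ} {φ : (Fin n → ℂ) → ℝ≥0∞} {a : Fin n → ℂ} {r : ℝ}
    (hφ : Measurable ((Metric.ball a r).indicator φ))
    (hsub : ∀ v ∈ Metric.ball (0 : Fin n → ℂ) r, ENNReal.ofReal (2 * Real.pi) * φ a ≤
      ∫⁻ θ in Set.Ioc 0 (2 * Real.pi), φ (a + Complex.exp (θ * Complex.I) • v)) :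
    φ a * volume (Metric.ball (0 : Fin n → ℂ) r) ≤ ∫⁻ v in Metric.ball a r, φ v := by
  set ψ : (Fin n → ℂ) → ℝ≥0∞ := fun v => (Metric.ball a r).indicator φ (a + v) with hψ
  have hψm : Measurable ψ := hφ.comp (measurable_const_add a)
  have hc0 : ENNReal.ofReal (2 * Real.pi) ≠ 0 := by simp [Real.pi_pos]
  have h1 : ∫⁻ v, ψ v = ∫⁻ v in Metric.ball a r, φ v := by
    rw [← lintegral_indicator Metric.isOpen_ball.measurableSet]
    exact lintegral_add_left_eq_self (μ := volume) ((Metric.ball a r).indicator φ) a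
  rw [← h1, ← ENNReal.mul_le_mul_iff_right hc0 ENNReal.ofReal_ne_top,
    ← lintegral_lintegral_exp_smul hψm, ← mul_assoc, ← setLIntegral_const,
    ← lintegral_indicator Metric.isOpen_ball.measurableSet]
  refine lintegral_mono fun v => ?_
  by_cases hv : v ∈ Metric.ball (0 : Fin n → ℂ) r
  · rw [Set.indicator_of_mem hv]
    refine (hsub v hv).trans_eq (lintegral_congr fun θ => ?_)
    have : a + Complex.exp (θ * Complex.I) • v ∈ Metric.ball a r := by
      simpa [norm_smul, Complex.norm_exp_ofReal_mul_I] using hv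
    simp [hψ, Set.indicator_of_mem this]
  · simp [Set.indicator_of_notMem hv]

/-! ### One variable -/

theorem inv_factorial_smul_iteratedDeriv_eq {g : ℂ → ℂ} (hg : DiffContOnCl ℂ g (Metric.ball 0 1))
    (d : ℕ) :
    ((d.factorial : ℂ)⁻¹ * iteratedDeriv d g 0 : ℂ) = (2 * Real.pi : ℝ)⁻¹ •
      ∫ θ in (0:ℝ)..(2 * Real.pi),
        Complex.exp (-(d * (θ * Complex.I))) * g (Complex.exp (θ * Complex.I)) := by
  have h := hg.circleIntegral_one_div_sub_center_pow_smul one_pos d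
  have h2 : (∮ z in C(0, 1), (1 / (z - 0) ^ (d + 1)) • g z) = Complex.I *
      ∫ θ in (0:ℝ)..(2 * Real.pi),
        Complex.exp (-(d * (θ * Complex.I))) * g (Complex.exp (θ * Complex.I)) := by
    rw [circleIntegral, ← intervalIntegral.integral_const_mul]
    refine intervalIntegral.integral_congr fun θ _ => ?_
    simp only [deriv_circleMap, circleMap, Complex.ofReal_one, one_mul, zero_add, sub_zero,
      smul_eq_mul, pow_succ, Complex.exp_neg, Complex.exp_nat_mul]
    have := Complex.exp_ne_zero (θ * Complex.I)
    field_simp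
  rw [h2] at h
  have hI : (Complex.I : ℂ) ≠ 0 := Complex.I_ne_zero
  have hpi : (Real.pi : ℂ) ≠ 0 := by exact_mod_cast Real.pi_ne_zero
  have h3 : (∫ θ in (0:ℝ)..(2 * Real.pi),
        Complex.exp (-(d * (θ * Complex.I))) * g (Complex.exp (θ * Complex.I))) =
      2 * Real.pi * ((d.factorial : ℂ)⁻¹ * iteratedDeriv d g 0) := by
    apply mul_left_cancel₀ hI
    rw [h, smul_eq_mul]; ring
  rw [h3, Complex.real_smul]
  push_cast
  field_simp

theorem enorm_sq_integral_le {α : Type*} [MeasurableSpace α] (μ : Measure α) [IsProbabilityMeasure μ]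
    (g : α → ℂ) (hg : AEStronglyMeasurable g μ) :
    ‖∫ x, g x ∂μ‖ₑ ^ 2 ≤ ∫⁻ x, ‖g x‖ₑ ^ 2 ∂μ := by
  have h1 := enorm_integral_le_lintegral_enorm (μ := μ) g
  rw [← eLpNorm_one_eq_lintegral_enorm] at h1
  have h2 := h1.trans (eLpNorm_le_eLpNorm_of_exponent_le (q := 2) (by norm_num) hg)
  have h3 := pow_le_pow_left' h2 2
  refine h3.trans_eq ?_
  have := eLpNorm_nnreal_pow_eq_lintegral (f := g) (μ := μ) (p := 2) (by norm_num)
  rw [NNReal.coe_ofNat, ENNReal.coe_ofNat] at this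
  simpa only [ENNReal.rpow_ofNat] using this

theorem enorm_sq_taylorCoeff_le {g : ℂ → ℂ} (hg : DiffContOnCl ℂ g (Metric.ball 0 1)) (d : ℕ) :
    ENNReal.ofReal (2 * Real.pi) * ‖((d.factorial : ℂ)⁻¹ * iteratedDeriv d g 0 : ℂ)‖ₑ ^ 2 ≤
      ∫⁻ θ in Set.Ioc 0 (2 * Real.pi), ‖g (Complex.exp (θ * Complex.I))‖ₑ ^ 2 := by
  have hcont : Continuous fun θ : ℝ =>
      Complex.exp (-(d * (θ * Complex.I))) * g (Complex.exp (θ * Complex.I)) := by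
    refine Continuous.mul (by fun_prop) ?_
    refine hg.continuousOn.comp_continuous (by fun_prop) fun θ => ?_
    rw [closure_ball _ one_ne_zero]
    simp [Complex.norm_exp_ofReal_mul_I]
  have hc0 : ENNReal.ofReal (2 * Real.pi) ≠ 0 := by simp [Real.pi_pos]
  have hc1 : ENNReal.ofReal (2 * Real.pi) ≠ ⊤ := ENNReal.ofReal_ne_top
  set μ : Measure ℝ := (ENNReal.ofReal (2 * Real.pi))⁻¹ •
    volume.restrict (Set.Ioc 0 (2 * Real.pi)) with hμ
  have : IsProbabilityMeasure μ := ⟨by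
    rw [hμ, Measure.smul_apply, Measure.restrict_apply_univ, Real.volume_Ioc, sub_zero, smul_eq_mul,
      ENNReal.inv_mul_cancel hc0 hc1]⟩
  rw [inv_factorial_smul_iteratedDeriv_eq hg, intervalIntegral.integral_of_le (by positivity)]
  have h := enorm_sq_integral_le μ _ hcont.aestronglyMeasurable
  rw [hμ, integral_smul_measure, lintegral_smul_measure, ENNReal.toReal_inv,
    ENNReal.toReal_ofReal (by positivity)] at h
  refine (mul_le_mul_right h _).trans_eq ?_
  rw [smul_eq_mul, ← mul_assoc, ENNReal.mul_inv_cancel hc0 hc1, one_mul]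
  refine lintegral_congr fun θ => ?_
  rw [enorm_mul, ← ofReal_norm (Complex.exp _), Complex.norm_exp]
  simp

theorem posLog_norm_le_circleAverage {g : ℂ → ℂ} (hg : Differentiable ℂ g) :
    Real.posLog ‖g 0‖ ≤ Real.circleAverage (fun z => Real.posLog ‖g z‖) 0 1 := by
  have hci : CircleIntegrable (fun z => Real.posLog ‖g z‖) 0 1 := by
    apply ContinuousOn.circleIntegrable zero_le_one
    have := hg.continuous
    fun_prop
  have hnn : 0 ≤ Real.circleAverage (fun z => Real.posLog ‖g z‖) 0 1 :=
    Real.circleAverage_nonneg_of_nonneg fun _ _ => Real.posLog_nonneg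
  by_cases h0 : g 0 = 0
  · simpa [h0] using hnn
  rw [Real.posLog_apply]
  refine max_le hnn ?_
  have han : AnalyticOnNhd ℂ g (Metric.closedBall 0 |1|) := fun z _ => hg.analyticAt z
  have hJ := han.circleAverage_log_norm one_ne_zero h0
  have hlog : Real.circleAverage (Real.log ‖g ·‖) 0 1 ≤
      Real.circleAverage (fun z => Real.posLog ‖g z‖) 0 1 := by
    refine Real.circleAverage_mono ?_ hci fun z _ => le_max_right _ _
    exact MeromorphicOn.circleIntegrable_log_norm fun z _ => (hg.analyticAt z).meromorphicAt
  refine le_trans ?_ hlog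
  rw [hJ, le_add_iff_nonneg_left]
  refine finsum_nonneg fun u => ?_
  by_cases hu : u ∈ Metric.closedBall (0:ℂ) |1|
  · refine mul_nonneg ?_ ?_
    · exact_mod_cast MeromorphicOn.AnalyticOnNhd.divisor_nonneg han u
    · have hu1 : ‖u‖ ≤ 1 := by simpa using hu
      rcases eq_or_ne u 0 with rfl | hu0
      · simp
      · apply Real.log_nonneg
        simp only [zero_sub, norm_neg, one_mul]
        exact (one_le_inv₀ (norm_pos_iff.2 hu0)).2 hu1
  · rw [Function.locallyFinsuppWithin.apply_eq_zero_of_notMem _ hu]; simp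

theorem ofReal_posLog_le_lintegral {g : ℂ → ℂ} (hg : Differentiable ℂ g) :
    ENNReal.ofReal (2 * Real.pi) * ENNReal.ofReal (Real.posLog ‖g 0‖) ≤
      ∫⁻ θ in Set.Ioc 0 (2 * Real.pi),
        ENNReal.ofReal (Real.posLog ‖g (Complex.exp (θ * Complex.I))‖) := by
  have h := posLog_norm_le_circleAverage hg
  have hcont : Continuous fun θ : ℝ => Real.posLog ‖g (Complex.exp (θ * Complex.I))‖ := by
    have := hg.continuous
    fun_prop
  rw [← ENNReal.ofReal_mul (by positivity), ← ofReal_integral_eq_lintegral_ofReal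
    ((hcont.integrableOn_Icc).mono_set Set.Ioc_subset_Icc_self)
    (ae_of_all _ fun _ => Real.posLog_nonneg)]
  apply ENNReal.ofReal_le_ofReal
  rw [Real.circleAverage, intervalIntegral.integral_of_le (by positivity)] at h
  simp only [circleMap, Complex.ofReal_one, one_mul, zero_add, smul_eq_mul] at h
  rwa [← le_inv_mul_iff₀ (by positivity)]

/-! ### Entire functions of polynomial growth -/

theorem iteratedDeriv_eq_zero_of_growth {g : ℂ → ℂ} (hg : Differentiable ℂ g) {d : ℕ} {C : ℝ}
    (hC : ∀ t, ‖g t‖ ≤ C * (1 + ‖t‖) ^ d) {k : ℕ} (hk : d < k) : iteratedDeriv k g 0 = 0 := by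
  have hC0 : 0 ≤ C := by simpa using (norm_nonneg _).trans (hC 0)
  have hb : ∀ R : ℝ, 1 ≤ R → ‖iteratedDeriv k g 0‖ ≤ k.factorial * C * 2 ^ d * R⁻¹ := by
    intro R hR
    have hR0 : 0 < R := by linarith
    have h1 := Complex.norm_iteratedDeriv_le_of_forall_mem_sphere_norm_le (c := 0) k hR0
      hg.diffContOnCl (C := C * (1 + R) ^ d) fun z hz => by
        simpa [mem_sphere_zero_iff_norm.1 hz] using hC z
    refine h1.trans ?_
    have h2 : (1 + R) ^ d ≤ (2 * R) ^ d := pow_le_pow_left₀ (by positivity) (by linarith) _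
    have h3 : R ^ d * R ≤ R ^ k := by
      rw [← pow_succ]; exact pow_le_pow_right₀ hR hk
    calc k.factorial * (C * (1 + R) ^ d) / R ^ k
        ≤ k.factorial * (C * (2 * R) ^ d) / (R ^ d * R) := by gcongr
      _ = _ := by rw [mul_pow]; field_simp
  have hlim : Tendsto (fun R : ℝ => k.factorial * C * 2 ^ d * R⁻¹) atTop (𝓝 0) := by
    simpa using tendsto_inv_atTop_zero.const_mul ((k.factorial : ℝ) * C * 2 ^ d)
  have := ge_of_tendsto hlim ((eventually_ge_atTop 1).mono hb)
  simpa using this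

theorem exists_polynomial_of_growth {g : ℂ → ℂ} (hg : Differentiable ℂ g) {d : ℕ} {C : ℝ}
    (hC : ∀ t, ‖g t‖ ≤ C * (1 + ‖t‖) ^ d) :
    ∃ p : Polynomial ℂ, p.degree < (d + 1 : ℕ) ∧ ∀ t, p.eval t = g t := by
  refine ⟨∑ k ∈ Finset.range (d + 1),
    Polynomial.C ((k.factorial : ℂ)⁻¹ * iteratedDeriv k g 0) * Polynomial.X ^ k, ?_, fun t => ?_⟩
  · rw [Finset.sum_range]; exact Polynomial.degree_sum_fin_lt _
  · rw [Polynomial.eval_finsetSum, ← Complex.taylorSeries_eq_of_entire' 0 t hg,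
      tsum_eq_sum (s := Finset.range (d + 1))]
    · simp
    · intro k hk
      rw [iteratedDeriv_eq_zero_of_growth hg hC (by simpa using hk)]
      simp

/-- An entire function of degree `≤ d` is determined by its values at `0, …, d`. -/
theorem eq_sum_lagrange_of_growth {g : ℂ → ℂ} (hg : Differentiable ℂ g) {d : ℕ} {C : ℝ}
    (hC : ∀ t, ‖g t‖ ≤ C * (1 + ‖t‖) ^ d) (t : ℂ) :
    g t = ∑ j ∈ Finset.range (d + 1),
      g j * (Lagrange.basis (Finset.range (d + 1)) (fun k : ℕ => (k : ℂ)) j).eval t := by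
  obtain ⟨p, hp, hpg⟩ := exists_polynomial_of_growth hg hC
  have h := Lagrange.eq_interpolate (s := Finset.range (d + 1)) (v := fun k : ℕ => (k : ℂ))
    (f := p) (fun a _ b _ hab => by simpa using hab) (by simpa using hp)
  rw [← hpg t]
  conv_lhs => rw [h]
  simp [Lagrange.interpolate_apply, Polynomial.eval_finsetSum, hpg]

theorem exists_mvPolynomial_of_growth (d : ℕ) : ∀ (n : ℕ) (g : (Fin n → ℂ) → ℂ) (C : ℝ),
    Differentiable ℂ g → (∀ z, ‖g z‖ ≤ C * (1 + ‖z‖) ^ d) →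
    ∃ P : MvPolynomial (Fin n) ℂ, ∀ z, MvPolynomial.eval z P = g z := by
  intro n
  induction n with
  | zero =>
    intro g C _ _
    exact ⟨MvPolynomial.C (g 0), fun z => by simp [Subsingleton.elim z 0]⟩
  | succ n ih =>
    intro g C hg hC
    have hC0 : 0 ≤ C := by simpa using (norm_nonneg _).trans (hC 0)
    have hcons : ∀ (t : ℂ) (z : Fin n → ℂ),
        ‖g (Fin.cons t z)‖ ≤ C * ((1 + ‖t‖) ^ d * (1 + ‖z‖) ^ d) := by
      intro t z
      refine (hC _).trans ?_
      rw [← mul_pow]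
      have : ‖(Fin.cons t z : Fin (n + 1) → ℂ)‖ ≤ ‖t‖ + ‖z‖ := by
        refine (pi_norm_le_iff_of_nonneg (by positivity)).2 fun i => ?_
        refine Fin.cases ?_ (fun i => ?_) i
        · simp
        · simpa using (norm_le_pi_norm z i).trans (le_add_of_nonneg_left (norm_nonneg t))
      gcongr
      nlinarith [norm_nonneg t, norm_nonneg z]
    have hslice : ∀ t : ℂ, ∃ P : MvPolynomial (Fin n) ℂ, ∀ z, MvPolynomial.eval z P =
        g (Fin.cons t z) := by
      intro t
      refine ih (fun z => g (Fin.cons t z)) (C * (1 + ‖t‖) ^ d) (hg.comp ?_) fun z => ?_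
      · refine differentiable_pi.2 fun i => Fin.cases ?_ (fun i => ?_) i
        · simp
        · simpa using differentiable_apply i
      · rw [mul_assoc]; exact hcons t z
    choose Q hQ using hslice
    refine ⟨∑ j ∈ Finset.range (d + 1), MvPolynomial.rename Fin.succ (Q j) *
      Polynomial.aeval (MvPolynomial.X 0)
        (Lagrange.basis (Finset.range (d + 1)) (fun k : ℕ => (k : ℂ)) j), fun z => ?_⟩
    have hline := eq_sum_lagrange_of_growth (g := fun t => g (Fin.cons t (Fin.tail z))) (d := d)
      (C := C * (1 + ‖Fin.tail z‖) ^ d) ?_ (fun t => ?_) (z 0)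
    · rw [Fin.cons_self_tail] at hline
      rw [hline, map_sum]
      refine Finset.sum_congr rfl fun j _ => ?_
      rw [map_mul, MvPolynomial.eval_rename, ← hQ]
      congr 1
      rw [Polynomial.aeval_def, Polynomial.hom_eval₂]
      simp only [MvPolynomial.eval_X, Polynomial.eval, MvPolynomial.algebraMap_eq]
      congr 1
      ext; simp
    · refine hg.comp (differentiable_pi.2 fun i => Fin.cases ?_ (fun i => ?_) i)
      · simp
      · simp
    · rw [mul_assoc, mul_comm ((1 + ‖Fin.tail z‖) ^ d)]; exact hcons t _

theorem eval_smul_of_isHomogeneous {σ : Type*} {P : MvPolynomial σ ℂ} {d : ℕ}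
    (hP : P.IsHomogeneous d) (c : ℂ) (z : σ → ℂ) :
    MvPolynomial.eval (c • z) P = c ^ d * MvPolynomial.eval z P := by
  rw [MvPolynomial.eval_eq, MvPolynomial.eval_eq, Finset.mul_sum]
  refine Finset.sum_congr rfl fun m hm => ?_
  have hdeg : ∑ i ∈ m.support, m i = d := by
    simpa [Finsupp.weight_apply, Finsupp.sum] using hP (MvPolynomial.mem_support_iff.1 hm)
  simp only [Pi.smul_apply, smul_eq_mul, mul_pow, Finset.prod_mul_distrib, Finset.prod_pow_eq_pow_sum,
    hdeg]
  ring

theorem exists_isHomogeneous_eval_eq {n d : ℕ} {g : (Fin n → ℂ) → ℂ}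
    (hhom : ∀ (c : ℂ) z, g (c • z) = c ^ d * g z)
    (hP : ∃ P : MvPolynomial (Fin n) ℂ, ∀ z, MvPolynomial.eval z P = g z) :
    ∃ P : MvPolynomial (Fin n) ℂ, P.IsHomogeneous d ∧ ∀ z, MvPolynomial.eval z P = g z := by
  obtain ⟨P, hP⟩ := hP
  refine ⟨P.homogeneousComponent d, MvPolynomial.homogeneousComponent_isHomogeneous d P,
    fun z => ?_⟩
  set N := P.totalDegree + 1
  have hpoly : (∑ k ∈ Finset.range N,
      Polynomial.C (MvPolynomial.eval z (P.homogeneousComponent k)) * Polynomial.X ^ k) =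
      Polynomial.C (g z) * Polynomial.X ^ d := by
    refine Polynomial.funext fun c => ?_
    have h := hhom c z
    rw [← hP (c • z), ← P.sum_homogeneousComponent, map_sum] at h
    simp only [Polynomial.eval_finsetSum, Polynomial.eval_mul, Polynomial.eval_C,
      Polynomial.eval_pow, Polynomial.eval_X]
    rw [mul_comm (g z), ← h]
    refine Finset.sum_congr rfl fun k _ => ?_
    rw [eval_smul_of_isHomogeneous (MvPolynomial.homogeneousComponent_isHomogeneous k P), mul_comm]
  have hcoeff := congrArg (fun p => Polynomial.coeff p d) hpoly
  simp only [Polynomial.finsetSum_coeff, Polynomial.coeff_C_mul, Polynomial.coeff_X_pow,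
    if_true, mul_one, mul_ite, mul_zero, Finset.sum_ite_eq, Finset.mem_range] at hcoeff
  rw [← hcoeff]
  split_ifs with hd
  · rfl
  · rw [MvPolynomial.homogeneousComponent_eq_zero d P (by omega), map_zero]

/-! ### Homogeneous Taylor components -/

/-- The homogeneous component of degree `d` of the Taylor expansion of `f` at the origin. -/
def taylorHom {n : ℕ} (f : (Fin n → ℂ) → ℂ) (d : ℕ) (z : Fin n → ℂ) : ℂ :=
  (d.factorial : ℂ)⁻¹ * iteratedDeriv d (fun t : ℂ => f (t • z)) 0

theorem differentiableOn_comp_smul {n : ℕ} {f : (Fin n → ℂ) → ℂ} {U : Set (Fin n → ℂ)}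
    (hf : DifferentiableOn ℂ f U) {s : Set ℂ} {z : Fin n → ℂ} (hs : ∀ t ∈ s, t • z ∈ U) :
    DifferentiableOn ℂ (fun t : ℂ => f (t • z)) s :=
  hf.comp (by fun_prop) hs

theorem diffContOnCl_comp_smul {n : ℕ} {f : (Fin n → ℂ) → ℂ} {U : Set (Fin n → ℂ)}
    (hf : DifferentiableOn ℂ f U) {z : Fin n → ℂ} (hs : ∀ t : ℂ, ‖t‖ ≤ 1 → t • z ∈ U) :
    DiffContOnCl ℂ (fun t : ℂ => f (t • z)) (Metric.ball 0 1) := by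
  refine DifferentiableOn.diffContOnCl ?_
  rw [closure_ball _ one_ne_zero]
  exact differentiableOn_comp_smul hf fun t ht => hs t (by simpa using ht)

theorem smul_mem_ball_of_norm_le_one {n : ℕ} {r : ℝ} {z : Fin n → ℂ}
    (hz : z ∈ Metric.ball (0 : Fin n → ℂ) r) {t : ℂ} (ht : ‖t‖ ≤ 1) :
    t • z ∈ Metric.ball (0 : Fin n → ℂ) r := by
  rw [mem_ball_zero_iff] at hz ⊢
  rw [norm_smul]
  exact (mul_le_of_le_one_left (norm_nonneg z) ht).trans_lt hz

theorem taylorHom_smul {n : ℕ} {f : (Fin n → ℂ) → ℂ} {r : ℝ} (hr : 0 < r)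
    (hf : DifferentiableOn ℂ f (Metric.ball 0 r)) (d : ℕ) (c : ℂ) (z : Fin n → ℂ) :
    taylorHom f d (c • z) = c ^ d * taylorHom f d z := by
  have key : ∀ (c : ℂ) (z : Fin n → ℂ), ‖c‖ ≤ 1 →
      taylorHom f d (c • z) = c ^ d * taylorHom f d z := by
    intro c z hc
    set s : Set ℂ := Metric.ball 0 (r / (1 + ‖z‖)) with hs
    have hso : IsOpen s := Metric.isOpen_ball
    have h0 : (0 : ℂ) ∈ s := Metric.mem_ball_self (by positivity)
    have hg : DifferentiableOn ℂ (fun t : ℂ => f (t • z)) s := by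
      refine differentiableOn_comp_smul hf fun t ht => ?_
      rw [mem_ball_zero_iff, lt_div_iff₀ (by positivity)] at ht
      rw [mem_ball_zero_iff, norm_smul]
      nlinarith [norm_nonneg t]
    have h := iteratedDerivWithin_comp_const_smul (n := d) h0 hso.uniqueDiffOn
      (hg.contDiffOn hso) c fun t ht => by
        rw [mem_ball_zero_iff] at ht ⊢
        rw [norm_mul]
        exact (mul_le_of_le_one_left (norm_nonneg t) hc).trans_lt ht
    rw [iteratedDerivWithin_of_isOpen hso h0, mul_zero, iteratedDerivWithin_of_isOpen hso h0] at h
    simp only [taylorHom, smul_smul, mul_comm _ c]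
    rw [h, smul_eq_mul]
    ring
  rcases le_total ‖c‖ 1 with hc | hc
  · exact key c z hc
  · have hc0 : c ≠ 0 := norm_pos_iff.1 (by linarith)
    have h := key c⁻¹ (c • z) (by rw [norm_inv]; exact inv_le_one_of_one_le₀ hc)
    rw [inv_smul_smul₀ hc0] at h
    rw [h, inv_pow, mul_inv_cancel_left₀ (pow_ne_zero _ hc0)]

theorem norm_taylorHom_le {n : ℕ} {f : (Fin n → ℂ) → ℂ} {r C : ℝ}
    (hf : DifferentiableOn ℂ f (Metric.ball 0 r))
    (hC : ∀ z ∈ Metric.ball (0 : Fin n → ℂ) r, ‖f z‖ ≤ C) (d : ℕ) {z : Fin n → ℂ}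
    (hz : z ∈ Metric.ball (0 : Fin n → ℂ) r) : ‖taylorHom f d z‖ ≤ C := by
  have h := Complex.norm_iteratedDeriv_le_of_forall_mem_sphere_norm_le d one_pos
    (diffContOnCl_comp_smul hf fun t => smul_mem_ball_of_norm_le_one hz)
    fun t ht => hC _ (smul_mem_ball_of_norm_le_one hz (mem_sphere_zero_iff_norm.1 ht).le)
  rw [one_pow, div_one] at h
  rw [taylorHom, norm_mul, norm_inv, Complex.norm_natCast, inv_mul_le_iff₀ (by positivity)]
  exact h

theorem norm_fderiv_le_of_norm_le {n : ℕ} {f : (Fin n → ℂ) → ℂ} {x : Fin n → ℂ} {r C : ℝ}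
    (hr : 0 < r) (hf : DifferentiableOn ℂ f (Metric.ball x r))
    (hC : ∀ z ∈ Metric.ball x r, ‖f z‖ ≤ C) : ‖fderiv ℂ f x‖ ≤ 2 * C / r := by
  refine Complex.norm_fderiv_le_div_of_mapsTo_ball hf (fun z hz => ?_) hr
  rw [mem_closedBall_iff_norm]
  linarith [norm_sub_le (f z) (f x), hC z hz, hC x (Metric.mem_ball_self hr)]

theorem differentiableAt_taylorHom_of_norm_lt {n : ℕ} {f : (Fin n → ℂ) → ℂ} {r C : ℝ} (hr : 0 < r)
    (hf : DifferentiableOn ℂ f (Metric.ball 0 r))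
    (hC : ∀ z ∈ Metric.ball (0 : Fin n → ℂ) r, ‖f z‖ ≤ C) (d : ℕ) {z : Fin n → ℂ}
    (hz : z ∈ Metric.ball (0 : Fin n → ℂ) (r / 2)) : DifferentiableAt ℂ (taylorHom f d) z := by
  set e : ℝ → ℂ := fun θ => Complex.exp (θ * Complex.I) with he
  set e' : ℝ → ℂ := fun θ => Complex.exp (-(d * (θ * Complex.I))) with he'
  have hec : Continuous e := by fun_prop
  have hec' : Continuous e' := by fun_prop
  have hen : ∀ θ, ‖e θ‖ = 1 := fun θ => Complex.norm_exp_ofReal_mul_I θ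
  have hen' : ∀ θ, ‖e' θ‖ = 1 := fun θ => by simp [he', Complex.norm_exp]
  have hsub : Metric.ball (0 : Fin n → ℂ) (r / 2) ⊆ Metric.ball 0 r :=
    Metric.ball_subset_ball (by linarith)
  have hmem : ∀ {ρ : ℝ} {x : Fin n → ℂ} (θ), x ∈ Metric.ball (0 : Fin n → ℂ) ρ →
      e θ • x ∈ Metric.ball (0 : Fin n → ℂ) ρ := fun θ hx =>
    smul_mem_ball_of_norm_le_one hx (hen θ).le
  have hdiff : ∀ x ∈ Metric.ball (0 : Fin n → ℂ) r, DifferentiableAt ℂ f x := fun x hx =>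
    hf.differentiableAt (Metric.isOpen_ball.mem_nhds hx)
  have hcont : ∀ x ∈ Metric.ball (0 : Fin n → ℂ) r,
      Continuous fun θ => e' θ * f (e θ • x) := fun x hx =>
    hec'.mul (hf.continuousOn.comp_continuous (by fun_prop) fun θ => hmem θ hx)
  have hint := hasFDerivAt_integral_of_dominated_of_fderiv_le (𝕜 := ℂ)
    (μ := volume.restrict (Set.Ioc 0 (2 * Real.pi)))
    (F := fun x θ => e' θ * f (e θ • x))
    (F' := fun x θ => (e' θ * e θ) • fderiv ℂ f (e θ • x)) (x₀ := z)
    (bound := fun _ => 2 * C / (r / 2)) (Metric.isOpen_ball.mem_nhds hz)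
    (by
      filter_upwards [Metric.isOpen_ball.mem_nhds hz] with x hx
      exact (hcont x (hsub hx)).aestronglyMeasurable)
    ((hcont z (hsub hz)).integrableOn_Icc.mono_set Set.Ioc_subset_Icc_self)
    (by
      refine AEStronglyMeasurable.smul (hec'.mul hec).aestronglyMeasurable ?_
      exact ((measurable_fderiv ℂ f).comp
        (by fun_prop : Continuous fun θ => e θ • z).measurable).aestronglyMeasurable)
    (ae_of_all _ fun θ x hx => by
      rw [norm_smul, norm_mul, hen, hen', one_mul, one_mul]
      have hsub' : Metric.ball (e θ • x) (r / 2) ⊆ Metric.ball 0 r := fun y hy => by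
        have h1 := mem_ball_zero_iff.1 (hmem θ hx)
        have h2 := mem_ball_iff_norm.1 hy
        rw [mem_ball_zero_iff]
        linarith [norm_le_norm_sub_add y (e θ • x)]
      exact norm_fderiv_le_of_norm_le (by positivity) (hf.mono hsub') fun y hy => hC y (hsub' hy))
    (integrable_const _)
    (ae_of_all _ fun θ x hx => by
      have h1 : HasFDerivAt (fun x => e θ • x) (e θ • ContinuousLinearMap.id ℂ (Fin n → ℂ)) x :=
        (hasFDerivAt_id x).const_smul (e θ)
      have h2 := ((hdiff _ (hsub (hmem θ hx))).hasFDerivAt.comp x h1).const_mul (e' θ)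
      have h3 : (e' θ * e θ) • fderiv ℂ f (e θ • x) = e' θ • (fderiv ℂ f (e θ • x)).comp
          (e θ • ContinuousLinearMap.id ℂ (Fin n → ℂ)) := by
        ext v
        simp [mul_assoc]
      rw [h3]
      exact h2)
  refine ((hint.const_smul ((2 * Real.pi : ℝ)⁻¹)).differentiableAt).congr_of_eventuallyEq ?_
  filter_upwards [Metric.isOpen_ball.mem_nhds hz] with x hx
  rw [taylorHom, inv_factorial_smul_iteratedDeriv_eq
    (diffContOnCl_comp_smul hf fun t => smul_mem_ball_of_norm_le_one (hsub hx)),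
    intervalIntegral.integral_of_le (by positivity)]
  rfl

theorem exists_isHomogeneous_eval_eq_taylorHom {n : ℕ} {f : (Fin n → ℂ) → ℂ}
    {U : Set (Fin n → ℂ)} (hU : U ∈ 𝓝 0) (hf : DifferentiableOn ℂ f U) (d : ℕ) :
    ∃ P : MvPolynomial (Fin n) ℂ, P.IsHomogeneous d ∧
      ∀ z, MvPolynomial.eval z P = taylorHom f d z := by
  obtain ⟨r, hr, C, hrU, hC⟩ : ∃ r > 0, ∃ C : ℝ, Metric.ball 0 r ⊆ U ∧
      ∀ z ∈ Metric.ball (0 : Fin n → ℂ) r, ‖f z‖ ≤ C := by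
    have hc : ContinuousAt f 0 := (hf.differentiableAt hU).continuousAt
    have h1 : ∀ᶠ z in 𝓝 (0 : Fin n → ℂ), ‖f z‖ < ‖f 0‖ + 1 :=
      hc.norm.eventually_lt_const (lt_add_one _)
    obtain ⟨r, hr, h⟩ := Metric.mem_nhds_iff.1 (inter_mem hU h1)
    exact ⟨r, hr, ‖f 0‖ + 1, fun z hz => (h hz).1, fun z hz => (h hz).2.le⟩
  replace hf := hf.mono hrU
  have hhom := taylorHom_smul hr hf d
  have hscale : ∀ z : Fin n → ℂ, ∃ w ∈ Metric.ball (0 : Fin n → ℂ) (r / 2),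
      z = ((4 * (1 + ‖z‖) / r : ℝ) : ℂ) • w := by
    intro z
    have hpos : 0 < 4 * (1 + ‖z‖) / r := by positivity
    refine ⟨((4 * (1 + ‖z‖) / r : ℝ) : ℂ)⁻¹ • z, ?_, ?_⟩
    · rw [mem_ball_zero_iff, norm_smul, norm_inv, Complex.norm_real, Real.norm_of_nonneg hpos.le,
        inv_mul_lt_iff₀ hpos]
      field_simp
      linarith [norm_nonneg z]
    · rw [smul_inv_smul₀]
      exact_mod_cast hpos.ne'
  have hdiff : Differentiable ℂ (taylorHom f d) := by
    intro z
    obtain ⟨w, hw, hz⟩ := hscale z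
    set c : ℂ := ((4 * (1 + ‖z‖) / r : ℝ) : ℂ) with hc
    have hc0 : c ≠ 0 := by
      rw [hc]
      exact_mod_cast (by positivity : 4 * (1 + ‖z‖) / r ≠ 0)
    have heq : taylorHom f d = fun x => c ^ d * taylorHom f d (c⁻¹ • x) := by
      funext x
      rw [← hhom, smul_inv_smul₀ hc0]
    rw [heq]
    refine DifferentiableAt.const_mul (DifferentiableAt.comp z (g := taylorHom f d) ?_
      (by fun_prop)) _
    rw [hz, inv_smul_smul₀ hc0]
    exact differentiableAt_taylorHom_of_norm_lt hr hf hC d hw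
  refine exists_isHomogeneous_eval_eq hhom
    (exists_mvPolynomial_of_growth d n _ (C * (4 / r) ^ d) hdiff fun z => ?_)
  obtain ⟨w, hw, hz⟩ := hscale z
  have hw' := norm_taylorHom_le hf hC d (Metric.ball_subset_ball (by linarith) hw)
  conv_lhs => rw [hz]
  rw [hhom, norm_mul, norm_pow, Complex.norm_real, Real.norm_of_nonneg (by positivity)]
  calc _ ≤ (4 * (1 + ‖z‖) / r) ^ d * C := by gcongr
    _ = _ := by rw [mul_div_right_comm, mul_pow]; ring

theorem lintegral_enorm_sq_taylorHom_le {n : ℕ} {f : (Fin n → ℂ) → ℂ} {D : Set (Fin n → ℂ)}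
    (hD : IsOpen D) (hbal : ∀ (t : ℂ), ‖t‖ ≤ 1 → ∀ z ∈ D, t • z ∈ D)
    (hf : DifferentiableOn ℂ f D) (d : ℕ) :
    ∫⁻ z in D, ‖taylorHom f d z‖ₑ ^ 2 ≤ ∫⁻ z in D, ‖f z‖ₑ ^ 2 := by
  set φ : (Fin n → ℂ) → ℝ≥0∞ := D.indicator fun z => ‖f z‖ₑ ^ 2 with hφ
  have hφm : Measurable φ := by
    classical
    rw [hφ, ← Set.piecewise_eq_indicator]
    exact ContinuousOn.measurable_piecewise
      ((ENNReal.continuous_pow 2).comp_continuousOn hf.continuousOn.enorm)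
      continuousOn_const hD.measurableSet
  have hc0 : ENNReal.ofReal (2 * Real.pi) ≠ 0 := by simp [Real.pi_pos]
  have hc1 : ENNReal.ofReal (2 * Real.pi) ≠ ⊤ := ENNReal.ofReal_ne_top
  rw [← ENNReal.mul_le_mul_iff_right hc0 hc1, ← lintegral_const_mul' _ _ hc1,
    ← lintegral_indicator hD.measurableSet, ← lintegral_indicator hD.measurableSet,
    ← lintegral_lintegral_exp_smul hφm]
  refine lintegral_mono fun v => ?_
  by_cases hv : v ∈ D
  · rw [Set.indicator_of_mem hv]
    refine (enorm_sq_taylorCoeff_le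
      (diffContOnCl_comp_smul hf fun t ht => hbal t ht v hv) d).trans_eq ?_
    refine lintegral_congr fun θ => ?_
    rw [hφ, Set.indicator_of_mem (hbal _ (Complex.norm_exp_ofReal_mul_I θ).le v hv)]
  · simp [Set.indicator_of_notMem hv]

/-! ### Sub-mean value estimates for entire functions -/

theorem differentiable_comp_add_smul {n : ℕ} {f : (Fin n → ℂ) → ℂ} (hf : Differentiable ℂ f)
    (a v : Fin n → ℂ) : Differentiable ℂ fun t : ℂ => f (a + t • v) :=
  hf.comp (by fun_prop)

theorem enorm_sq_mul_volume_ball_le {n : ℕ} {f : (Fin n → ℂ) → ℂ} (hf : Differentiable ℂ f)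
    (a : Fin n → ℂ) (r : ℝ) :
    ‖f a‖ₑ ^ 2 * volume (Metric.ball (0 : Fin n → ℂ) r) ≤
      ∫⁻ v in Metric.ball a r, ‖f v‖ₑ ^ 2 := by
  refine mul_volume_ball_le_lintegral (φ := fun v => ‖f v‖ₑ ^ 2) ?_ fun v _ => ?_
  · have := hf.continuous
    exact (by fun_prop : Measurable fun v => ‖f v‖ₑ ^ 2).indicator Metric.isOpen_ball.measurableSet
  · simpa using enorm_sq_taylorCoeff_le
      (differentiable_comp_add_smul hf a v).diffContOnCl 0

theorem ofReal_posLog_mul_volume_ball_le {n : ℕ} {f : (Fin n → ℂ) → ℂ} (hf : Differentiable ℂ f)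
    (a : Fin n → ℂ) (r : ℝ) :
    ENNReal.ofReal (Real.posLog ‖f a‖) * volume (Metric.ball (0 : Fin n → ℂ) r) ≤
      ∫⁻ v in Metric.ball a r, ENNReal.ofReal (Real.posLog ‖f v‖) := by
  refine mul_volume_ball_le_lintegral (φ := fun v => ENNReal.ofReal (Real.posLog ‖f v‖)) ?_
    fun v _ => ?_
  · have := hf.continuous
    have hc : Continuous fun v => ENNReal.ofReal (Real.posLog ‖f v‖) :=
      ENNReal.continuous_ofReal.comp (by fun_prop)
    exact hc.measurable.indicator Metric.isOpen_ball.measurableSet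
  · simpa using ofReal_posLog_le_lintegral (differentiable_comp_add_smul hf a v)

/-- **Hartogs' lemma**: a pointwise bound on the growth of `‖g d ·‖ ^ (1 / d)` is locally uniform. -/
theorem eventually_forall_norm_le_pow {n : ℕ} {g : ℕ → (Fin n → ℂ) → ℂ}
    (hg : ∀ d, Differentiable ℂ (g d)) {z₀ : Fin n → ℂ} {ρ q q' K B : ℝ} (hρ : 0 < ρ) (hq : 0 < q)
    (hqq' : q < q')
    (hbound : ∀ d, ∀ z ∈ Metric.ball z₀ (2 * ρ), ‖g d z‖ ≤ K * B ^ d)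
    (hlim : ∀ z ∈ Metric.ball z₀ (2 * ρ), ∀ᶠ d in atTop, ‖g d z‖ ≤ q ^ d) :
    ∀ᶠ d in atTop, ∀ z ∈ Metric.ball z₀ ρ, ‖g d z‖ ≤ q' ^ d := by
  set G : ℕ → (Fin n → ℂ) → ℂ := fun d z => ((q : ℂ) ^ d)⁻¹ * g d z with hG
  have hGd : ∀ d, Differentiable ℂ (G d) := fun d => (hg d).const_mul _
  have hGn : ∀ d z, ‖G d z‖ = ‖g d z‖ / q ^ d := fun d z => by
    rw [hG, norm_mul, norm_inv, norm_pow, Complex.norm_real, Real.norm_of_nonneg hq.le,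
      inv_mul_eq_div]
  set φ : ℕ → (Fin n → ℂ) → ℝ≥0∞ := fun d z => ENNReal.ofReal (Real.posLog ‖G d z‖ / d) with hφ
  have hφ0 : Tendsto (fun d => ∫⁻ z in Metric.ball z₀ (2 * ρ), φ d z) atTop (𝓝 0) := by
    rw [← lintegral_zero (μ := volume.restrict (Metric.ball z₀ (2 * ρ)))]
    refine tendsto_lintegral_of_dominated_convergence
      (fun _ => ENNReal.ofReal (Real.posLog K + Real.posLog (B / q))) (fun d => ?_) (fun d => ?_)
      ?_ ?_
    · have := (hGd d).continuous
      have hc : Continuous (φ d) := ENNReal.continuous_ofReal.comp (by fun_prop)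
      exact hc.measurable
    · refine (ae_restrict_iff' Metric.isOpen_ball.measurableSet).2 (ae_of_all _ fun z hz => ?_)
      apply ENNReal.ofReal_le_ofReal
      rcases Nat.eq_zero_or_pos d with rfl | hd
      · simpa using add_nonneg Real.posLog_nonneg Real.posLog_nonneg
      · have hd1 : (1 : ℝ) ≤ d := by exact_mod_cast hd
        rw [div_le_iff₀ (by linarith)]
        have h1 : ‖G d z‖ ≤ K * (B / q) ^ d := by
          rw [hGn, div_pow, ← mul_div_assoc]
          gcongr
          exact hbound d z hz
        refine (Real.posLog_le_posLog (norm_nonneg _) h1).trans (Real.posLog_mul.trans ?_)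
        rw [Real.posLog_pow, add_mul, mul_comm (d : ℝ)]
        have := Real.posLog_nonneg (x := K)
        gcongr
        exact le_mul_of_one_le_right this hd1
    · simpa using (ENNReal.mul_lt_top ENNReal.ofReal_lt_top measure_ball_lt_top).ne
    · refine (ae_restrict_iff' Metric.isOpen_ball.measurableSet).2 (ae_of_all _ fun z hz => ?_)
      refine tendsto_const_nhds.congr' ?_
      filter_upwards [hlim z hz] with d hd
      have : Real.posLog ‖G d z‖ = 0 := by
        rw [Real.posLog_eq_zero_iff, abs_norm, hGn]
        exact div_le_one_of_le₀ hd (by positivity)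
      simp [hφ, this]
  have hε : 0 < Real.log (q' / q) := Real.log_pos ((one_lt_div hq).2 hqq')
  have hV0 : volume (Metric.ball (0 : Fin n → ℂ) ρ) ≠ 0 := (Metric.measure_ball_pos _ _ hρ).ne'
  have hpos : 0 < ENNReal.ofReal (Real.log (q' / q)) * volume (Metric.ball (0 : Fin n → ℂ) ρ) :=
    ENNReal.mul_pos (by simpa using hε) hV0
  filter_upwards [hφ0.eventually_lt_const hpos, eventually_gt_atTop 0] with d hd hd0 z hz
  have hd0' : (0 : ℝ) < d := by exact_mod_cast hd0
  have hmean : φ d z * volume (Metric.ball (0 : Fin n → ℂ) ρ) ≤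
      ∫⁻ v in Metric.ball z₀ (2 * ρ), φ d v := by
    have hsub : Metric.ball z ρ ⊆ Metric.ball z₀ (2 * ρ) :=
      Metric.ball_subset_ball' (by linarith [Metric.mem_ball.1 hz])
    refine le_trans ?_ (lintegral_mono_set hsub)
    simp only [hφ, div_eq_inv_mul, ENNReal.ofReal_mul (inv_nonneg.2 hd0'.le)]
    rw [lintegral_const_mul' _ _ ENNReal.ofReal_ne_top, mul_assoc]
    exact mul_le_mul_right (ofReal_posLog_mul_volume_ball_le (hGd d) z ρ) _
  have hlt := lt_of_mul_lt_mul_right' (hmean.trans_lt hd)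
  rw [hφ, ENNReal.ofReal_lt_ofReal_iff hε, div_lt_iff₀ hd0'] at hlt
  have hlog : Real.log ‖G d z‖ ≤ d * Real.log (q' / q) := by
    rw [mul_comm]
    exact (le_max_right _ _).trans hlt.le
  rw [← Real.log_pow] at hlog
  rcases eq_or_ne (g d z) 0 with h0 | h0
  · rw [h0, norm_zero]
    exact pow_nonneg (hq.trans hqq').le _
  · have hGpos : 0 < ‖G d z‖ := by
      rw [hGn]
      exact div_pos (norm_pos_iff.2 h0) (pow_pos hq d)
    have hle := (Real.log_le_log_iff hGpos (pow_pos (div_pos (hq.trans hqq') hq) d)).1 hlog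
    rw [hGn, div_pow] at hle
    exact (div_le_div_iff_of_pos_right (pow_pos hq d)).1 hle

theorem differentiableAt_tsum_of_norm_le_geometric {n : ℕ} {g : ℕ → (Fin n → ℂ) → ℂ}
    (hg : ∀ d, Differentiable ℂ (g d)) {z₀ : Fin n → ℂ} {ρ q K : ℝ} (hρ : 0 < ρ) (hq : 0 ≤ q)
    (hq1 : q < 1) (hb : ∀ᶠ d in atTop, ∀ z ∈ Metric.ball z₀ ρ, ‖g d z‖ ≤ K * q ^ d) :
    DifferentiableAt ℂ (fun z => ∑' d, g d z) z₀ := by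
  obtain ⟨N, hN⟩ := eventually_atTop.1 hb
  have hgeo : Summable fun d => K * q ^ (d + N) :=
    ((summable_nat_add_iff N).2 (summable_geometric_of_lt_one hq hq1)).mul_left K
  have hsum : ∀ z ∈ Metric.ball z₀ ρ, Summable fun d => g (d + N) z := fun z hz =>
    Summable.of_norm_bounded hgeo fun d => hN (d + N) (Nat.le_add_left N d) z hz
  have hz₀ : z₀ ∈ Metric.ball z₀ (ρ / 2) := Metric.mem_ball_self (by positivity)
  have htail := hasFDerivAt_tsum_of_isPreconnected
    (f := fun d => g (d + N)) (f' := fun d => fderiv ℂ (g (d + N)))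
    (u := fun d => 2 * (K * q ^ (d + N)) / (ρ / 2)) ((hgeo.mul_left 2).div_const _)
    (Metric.isOpen_ball (x := z₀) (ε := ρ / 2))
    ((convex_ball z₀ (ρ / 2)).isPreconnected)
    (fun d z _ => (hg (d + N) z).hasFDerivAt)
    (fun d z hz => by
      refine norm_fderiv_le_of_norm_le (by positivity) (hg _).differentiableOn fun w hw => ?_
      refine hN (d + N) (Nat.le_add_left N d) w (Metric.ball_subset_ball' ?_ hw)
      linarith [Metric.mem_ball.1 hz])
    hz₀ (hsum z₀ (Metric.mem_ball_self hρ)) hz₀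
  have hhead : DifferentiableAt ℂ (fun z => ∑ d ∈ Finset.range N, g d z) z₀ := by
    have := fun d => hg d z₀
    fun_prop
  refine (hhead.add htail.differentiableAt).congr_of_eventuallyEq ?_
  filter_upwards [Metric.ball_mem_nhds z₀ hρ] with z hz
  exact (((summable_nat_add_iff N).1 (hsum z hz)).sum_add_tsum_nat_add N).symm

/-! ### The domain `{h < 1}` and the functions `Md`, `hBK` -/

theorem differentiable_eval {n : ℕ} (P : MvPolynomial (Fin n) ℂ) :
    Differentiable ℂ fun z : Fin n → ℂ => MvPolynomial.eval z P := by
  induction P using MvPolynomial.induction_on with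
  | C a => simp
  | add p q hp hq => simpa only [map_add] using hp.fun_add hq
  | mul_X p i hp =>
    simpa only [map_mul, MvPolynomial.eval_X] using hp.fun_mul (differentiable_apply i)

theorem exists_forall_norm_eval_le (n : ℕ) {r : ℝ} (hr : 0 < r) :
    ∃ K : ℝ, 1 ≤ K ∧ ∀ (P : MvPolynomial (Fin n) ℂ) (D : Set (Fin n → ℂ)) (a : Fin n → ℂ),
      Metric.ball a r ⊆ D → ∫⁻ w in D, ‖MvPolynomial.eval w P‖ₑ ^ 2 ≤ 1 →
        ‖MvPolynomial.eval a P‖ ≤ K := by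
  set V := volume (Metric.ball (0 : Fin n → ℂ) r) with hV
  have hV0 : V ≠ 0 := (Metric.measure_ball_pos _ _ hr).ne'
  have hV1 : V ≠ ⊤ := measure_ball_lt_top.ne
  refine ⟨max 1 V⁻¹.toReal, le_max_left _ _, fun P D a hD hP => ?_⟩
  have h1 : ‖MvPolynomial.eval a P‖ₑ ^ 2 ≤ V⁻¹ := by
    rw [ENNReal.le_inv_iff_mul_le]
    exact (enorm_sq_mul_volume_ball_le (differentiable_eval P) a r).trans
      ((lintegral_mono_set hD).trans hP)
  have h2 := ENNReal.toReal_mono (ENNReal.inv_ne_top.2 hV0) h1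
  rw [ENNReal.toReal_pow, toReal_enorm] at h2
  refine (pow_le_pow_iff_left₀ (norm_nonneg _) (by positivity) two_ne_zero).1 ?_
  calc ‖MvPolynomial.eval a P‖ ^ 2 ≤ max 1 V⁻¹.toReal := h2.trans (le_max_right _ _)
    _ ≤ max 1 V⁻¹.toReal ^ 2 := le_self_pow₀ (le_max_left _ _) two_ne_zero

theorem isOpen_setOf_lt_one {n : ℕ} {h : (Fin n → ℂ) → ℝ} (husc : UpperSemicontinuous h) :
    IsOpen {z | h z < 1} :=
  husc.isOpen_preimage 1

theorem AbsHomog.map_zero {n : ℕ} {h : (Fin n → ℂ) → ℝ} (hhom : AbsHomog h) : h 0 = 0 := by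
  simpa using hhom 0 0

theorem setOf_lt_one_mem_nhds {n : ℕ} {h : (Fin n → ℂ) → ℝ} (husc : UpperSemicontinuous h)
    (hhom : AbsHomog h) : {z | h z < 1} ∈ 𝓝 0 :=
  (isOpen_setOf_lt_one husc).mem_nhds (by simp [hhom.map_zero])

theorem enorm_eval_le_Md {n : ℕ} {h : (Fin n → ℂ) → ℝ} {d : ℕ} {P : MvPolynomial (Fin n) ℂ}
    (hP : P.IsHomogeneous d) (hP1 : ∫⁻ w in {w | h w < 1}, ‖MvPolynomial.eval w P‖ₑ ^ 2 ≤ 1)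
    (z : Fin n → ℂ) : ‖MvPolynomial.eval z P‖ₑ ≤ Md h d z :=
  le_iSup_of_le P (le_iSup_of_le hP (le_iSup_of_le hP1 le_rfl))

theorem hBK_le_of_lt {n : ℕ} {h : (Fin n → ℂ) → ℝ} (husc : UpperSemicontinuous h)
    (hhom : AbsHomog h) {w : Fin n → ℂ} {c : ℝ} (hc : 0 < c) (hw : h w < c) :
    hBK h w ≤ ENNReal.ofReal c := by
  have hcw : ((c : ℂ)⁻¹ • w) ∈ {z | h z < 1} := by
    rw [Set.mem_ofPred_eq, hhom, norm_inv, Complex.norm_real, Real.norm_of_nonneg hc.le,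
      inv_mul_lt_iff₀ hc, mul_one]
    exact hw
  obtain ⟨r, hr, hball⟩ := Metric.isOpen_iff.1 (isOpen_setOf_lt_one husc) _ hcw
  obtain ⟨K, hK1, hK⟩ := exists_forall_norm_eval_le n hr
  have hK0 : 0 < K := by linarith
  have hMd : ∀ d, Md h d w ≤ ENNReal.ofReal (c ^ d * K) := fun d => by
    refine iSup_le fun P => iSup_le fun hP => iSup_le fun hP1 => ?_
    have h1 := hK P _ _ hball hP1
    rw [eval_smul_of_isHomogeneous hP, norm_mul, norm_pow, norm_inv, Complex.norm_real,
      Real.norm_of_nonneg hc.le, inv_pow, inv_mul_le_iff₀ (by positivity)] at h1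
    rw [← enorm_eq_nnnorm, ← ofReal_norm]
    exact ENNReal.ofReal_le_ofReal h1
  have hlim : Tendsto (fun d : ℕ => ENNReal.ofReal (c * K ^ (1 / (d : ℝ)))) atTop
      (𝓝 (ENNReal.ofReal c)) := by
    refine ENNReal.tendsto_ofReal ?_
    simpa using (((Real.continuousAt_const_rpow hK0.ne').tendsto.comp
      tendsto_one_div_atTop_nhds_zero_nat).const_mul c)
  refine le_trans (limsup_le_limsup ?_) hlim.limsup_eq.le
  filter_upwards [eventually_gt_atTop 0] with d hd
  refine (ENNReal.rpow_le_rpow (hMd d) (by positivity)).trans_eq ?_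
  rw [ENNReal.ofReal_rpow_of_nonneg (by positivity) (by positivity),
    Real.mul_rpow (by positivity) hK0.le, one_div, Real.pow_rpow_inv_natCast hc.le hd.ne']

theorem hBKstar_le {n : ℕ} {h : (Fin n → ℂ) → ℝ} (hpos : ∀ z, 0 ≤ h z)
    (husc : UpperSemicontinuous h) (hhom : AbsHomog h) (z : Fin n → ℂ) :
    hBKstar h z ≤ ENNReal.ofReal (h z) := by
  have key : ∀ c, h z < c → hBKstar h z ≤ ENNReal.ofReal c := fun c hc =>
    limsup_le_of_le (h := (husc z c hc).mono fun w hw =>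
      hBK_le_of_lt husc hhom ((hpos z).trans_lt hc) hw)
  have hlim : Tendsto ENNReal.ofReal (𝓝[>] (h z)) (𝓝 (ENNReal.ofReal (h z))) :=
    ENNReal.continuous_ofReal.continuousAt.mono_left nhdsWithin_le_nhds
  exact ge_of_tendsto hlim (eventually_mem_nhdsWithin.mono key)

theorem exists_eventually_norm_eval_le_of_hBKstar_lt_one {n : ℕ} {h : (Fin n → ℂ) → ℝ}
    (husc : UpperSemicontinuous h) (hhom : AbsHomog h) {z₀ : Fin n → ℂ} (hz₀ : hBKstar h z₀ < 1) :
    ∃ ρ > 0, ∃ q : ℝ, 0 ≤ q ∧ q < 1 ∧ ∀ Q : ℕ → MvPolynomial (Fin n) ℂ,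
      (∀ d, (Q d).IsHomogeneous d) →
      (∀ d, ∫⁻ w in {w | h w < 1}, ‖MvPolynomial.eval w (Q d)‖ₑ ^ 2 ≤ 1) →
      ∀ᶠ d in atTop, ∀ z ∈ Metric.ball z₀ ρ, ‖MvPolynomial.eval z (Q d)‖ ≤ q ^ d := by
  obtain ⟨q, hq, hzq, hq1⟩ := ENNReal.lt_iff_exists_real_btwn.1 hz₀
  have hq1 : q < 1 := by simpa using hq1
  have hq0 : 0 < q := ENNReal.ofReal_pos.1 (bot_le.trans_lt hzq)
  obtain ⟨δ, hδ, hball⟩ := Metric.mem_nhds_iff.1 (eventually_lt_of_limsup_lt hzq)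
  obtain ⟨r, hr, hrD⟩ := Metric.mem_nhds_iff.1 (setOf_lt_one_mem_nhds husc hhom)
  obtain ⟨K, hK1, hK⟩ := exists_forall_norm_eval_le n (half_pos hr)
  refine ⟨δ / 2, half_pos hδ, (1 + q) / 2, by linarith, by linarith, fun Q hQ hQ1 => ?_⟩
  have hB : 0 < (‖z₀‖ + δ) * 2 / r := by positivity
  refine eventually_forall_norm_le_pow (K := K) (B := (‖z₀‖ + δ) * 2 / r)
    (fun d => differentiable_eval (Q d)) (half_pos hδ) hq0
    (by linarith) (fun d z hz => ?_) (fun z hz => ?_)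
  · rw [mul_div_cancel₀ _ two_ne_zero] at hz
    set w := (((‖z₀‖ + δ) * 2 / r : ℝ) : ℂ)⁻¹ • z with hw
    have hzw : z = (((‖z₀‖ + δ) * 2 / r : ℝ) : ℂ) • w := by
      rw [hw, smul_inv_smul₀]
      exact_mod_cast hB.ne'
    have hwr : ‖w‖ < r / 2 := by
      rw [hw, norm_smul, norm_inv, Complex.norm_real, Real.norm_of_nonneg hB.le,
        inv_mul_lt_iff₀ hB]
      field_simp
      linarith [mem_ball_iff_norm.1 hz, norm_le_norm_sub_add z z₀]
    have hsub : Metric.ball w (r / 2) ⊆ {z | h z < 1} := by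
      refine (Metric.ball_subset_ball' ?_).trans hrD
      rw [dist_zero_right]
      linarith
    have h1 := hK (Q d) _ w hsub (hQ1 d)
    rw [hzw, eval_smul_of_isHomogeneous (hQ d), norm_mul, norm_pow, Complex.norm_real,
      Real.norm_of_nonneg hB.le, mul_comm]
    gcongr
  · rw [mul_div_cancel₀ _ two_ne_zero] at hz
    have h1 : hBK h z < ENNReal.ofReal q := hball hz
    filter_upwards [eventually_lt_of_limsup_lt h1, eventually_gt_atTop 0] with d hd hd0
    have hd0' : (0 : ℝ) < d := by exact_mod_cast hd0
    rw [one_div, ENNReal.rpow_inv_lt_iff hd0', ENNReal.rpow_natCast,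
      ← ENNReal.ofReal_pow hq0.le] at hd
    have h2 := (enorm_eval_le_Md (hQ d) (hQ1 d) z).trans hd.le
    rwa [← ofReal_norm, ENNReal.ofReal_le_ofReal_iff (by positivity)] at h2

theorem tsum_taylorHom_eq {n : ℕ} {f : (Fin n → ℂ) → ℂ} {U : Set (Fin n → ℂ)}
    (hf : DifferentiableOn ℂ f U) {z : Fin n → ℂ} {R : ℝ} (hR : 1 < R)
    (hU : ∀ t ∈ Metric.ball (0 : ℂ) R, t • z ∈ U) : ∑' d, taylorHom f d z = f z := by
  have h := Complex.taylorSeries_eq_on_ball' (c := 0) (z := 1) (r := R) (by simpa using hR)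
    (differentiableOn_comp_smul hf hU)
  simpa [taylorHom] using h

theorem exists_smul_isAdmissible {n : ℕ} {f : (Fin n → ℂ) → ℂ} {D : Set (Fin n → ℂ)}
    (hD : IsOpen D) (hD0 : D ∈ 𝓝 0) (hbal : ∀ (t : ℂ), ‖t‖ ≤ 1 → ∀ z ∈ D, t • z ∈ D)
    (hf : MemL2h D f) :
    ∃ s : ℝ, 0 < s ∧ ∃ Q : ℕ → MvPolynomial (Fin n) ℂ, (∀ d, (Q d).IsHomogeneous d) ∧
      (∀ d, ∫⁻ w in D, ‖MvPolynomial.eval w (Q d)‖ₑ ^ 2 ≤ 1) ∧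
      ∀ d z, MvPolynomial.eval z (Q d) = s * taylorHom f d z := by
  choose P hP hPe using exists_isHomogeneous_eval_eq_taylorHom hD0 hf.1
  set N := ∫⁻ z in D, ‖f z‖ₑ ^ 2 with hN
  have hNtop : N ≠ ⊤ := hf.2.ne
  set s : ℝ := (1 + N.toReal)⁻¹ with hs
  have hs0 : 0 < s := by positivity
  refine ⟨s, hs0, fun d => MvPolynomial.C (s : ℂ) * P d, fun d => ?_, fun d => ?_, fun d z => ?_⟩
  · simpa using (MvPolynomial.isHomogeneous_C (Fin n) (s : ℂ)).mul (hP d)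
  · simp only [map_mul, MvPolynomial.eval_C, hPe, enorm_mul, mul_pow]
    rw [lintegral_const_mul' _ _ (by simp)]
    refine (mul_le_mul_right (lintegral_enorm_sq_taylorHom_le hD hbal hf.1 d) _).trans ?_
    rw [← hN, ← ENNReal.ofReal_toReal hNtop, ← ofReal_norm, Complex.norm_real,
      Real.norm_of_nonneg hs0.le, ← ENNReal.ofReal_pow hs0.le,
      ← ENNReal.ofReal_mul (by positivity), ENNReal.ofReal_le_one, hs, inv_pow,
      inv_mul_le_iff₀ (by positivity)]
    nlinarith [ENNReal.toReal_nonneg (a := N)]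
  · simp [hPe]

/-- `h_BK^* ≤ h`, and every `f ∈ L²_h(D_h)` extends holomorphically to
`D_{h_BK^*} = {h_BK^* < 1}`. -/
theorem statement_0 (n : ℕ) (h : (Fin n → ℂ) → ℝ)
    (hpos : ∀ z, 0 ≤ h z) (husc : UpperSemicontinuous h) (hhom : AbsHomog h)
    (hne : ∃ z, h z ≠ 0) :
    (∀ z, hBKstar h z ≤ ENNReal.ofReal (h z)) ∧
      ∀ f : (Fin n → ℂ) → ℂ, MemL2h {z | h z < 1} f →
        ∃ F : (Fin n → ℂ) → ℂ, DifferentiableOn ℂ F {z | hBKstar h z < 1} ∧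
          Set.EqOn F f {z | h z < 1} := by
  refine ⟨hBKstar_le hpos husc hhom, fun f hf => ?_⟩
  have hbal : ∀ t : ℂ, ‖t‖ ≤ 1 → ∀ z ∈ {z | h z < 1}, t • z ∈ {z | h z < 1} := fun t ht z hz => by
    rw [Set.mem_ofPred_eq, hhom]
    exact (mul_le_of_le_one_left (hpos z) ht).trans_lt hz
  obtain ⟨s, hs, Q, hQ, hQ1, hQe⟩ := exists_smul_isAdmissible (isOpen_setOf_lt_one husc)
    (setOf_lt_one_mem_nhds husc hhom) hbal hf
  have hsc : (s : ℂ) ≠ 0 := by exact_mod_cast hs.ne'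
  have hT : ∀ d, taylorHom f d = fun z => (s : ℂ)⁻¹ * MvPolynomial.eval z (Q d) := fun d =>
    funext fun z => by rw [hQe, inv_mul_cancel_left₀ hsc]
  refine ⟨fun z => ∑' d, taylorHom f d z, fun z₀ hz₀ => ?_, fun z hz => ?_⟩
  · obtain ⟨ρ, hρ, q, hq0, hq1, hq⟩ :=
      exists_eventually_norm_eval_le_of_hBKstar_lt_one husc hhom hz₀
    refine (differentiableAt_tsum_of_norm_le_geometric (K := s⁻¹) (fun d => ?_) hρ hq0 hq1
      ?_).differentiableWithinAt
    · rw [hT]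
      exact (differentiable_eval (Q d)).const_mul _
    · filter_upwards [hq Q hQ hQ1] with d hd z hz
      rw [hT, norm_mul, norm_inv, Complex.norm_real, Real.norm_of_nonneg hs.le]
      gcongr
      exact hd z hz
  · have hz1 : h z < 1 := hz
    have hz0 := hpos z
    refine tsum_taylorHom_eq hf.1 (R := 2 / (1 + h z))
      ((one_lt_div (by linarith)).2 (by linarith)) fun t ht => ?_
    rw [mem_ball_zero_iff, lt_div_iff₀ (by linarith)] at ht
    rw [Set.mem_ofPred_eq, hhom]
    nlinarith [norm_nonneg t]
end
end

section
/- Let D = D_h be a pseudoconvex balanced domain in ℂ^n with finite Lebesgue volume λ(D) < ∞. Then K_D(0) = 1/λ(D), where K_D(0) = sup{|f(0)|² : f holomorphic on D, ∫_D |f|² dλ ≤ 1}. -/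
open MeasureTheory Filter Topology
open scoped ENNReal NNReal

noncomputable section

/-- Multiplication by a unimodular complex number preserves Lebesgue measure on `ℂ^n`. -/
theorem measurePreserving_circle_smul {n : ℕ} (c : Circle) :
    MeasurePreserving (fun z : Fin n → ℂ => (c : ℂ) • z) volume volume :=
  volume_preserving_pi (fun _ : Fin n => (rotation c).measurePreserving)

/-- Sub-mean value property of `|f|²` on a complex disc through the origin. -/
theorem enorm_sq_le_lintegral_circle {n : ℕ} {D : Set (Fin n → ℂ)} (hD : IsOpen D)
    {f : (Fin n → ℂ) → ℂ} (hf : DifferentiableOn ℂ f D) {z : Fin n → ℂ}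
    (hz : ∀ w : ℂ, ‖w‖ ≤ 1 → w • z ∈ D) :
    ENNReal.ofReal (2 * Real.pi) * ‖f 0‖ₑ ^ 2 ≤
      ∫⁻ θ in Set.Ioc (0 : ℝ) (2 * Real.pi), ‖f (Complex.exp (θ * Complex.I) • z)‖ₑ ^ 2 := by
  have hd : DifferentiableOn ℂ (fun w : ℂ => f (w • z) ^ 2) (Metric.closedBall 0 |1|) := by
    intro w hw
    have h1 : DifferentiableAt ℂ f (w • z) :=
      hf.differentiableAt (hD.mem_nhds (hz w (by simpa using hw)))
    exact ((h1.comp w (by fun_prop : DifferentiableAt ℂ (fun w : ℂ => w • z) w)).pow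
      2).differentiableWithinAt
  have havg : Real.circleAverage (fun w : ℂ => f (w • z) ^ 2) 0 1 = f 0 ^ 2 := by
    simpa using (hd.diffContOnCl_ball subset_rfl).circleAverage
  have hint : ∫ θ in Set.Ioc (0 : ℝ) (2 * Real.pi), f (Complex.exp (θ * Complex.I) • z) ^ 2
      = ((2 * Real.pi : ℝ) : ℂ) * f 0 ^ 2 := by
    rw [← havg, Real.circleAverage_def, intervalIntegral.integral_of_le Real.two_pi_pos.le,
      Complex.real_smul, ← mul_assoc, ← Complex.ofReal_mul, mul_inv_cancel₀ Real.two_pi_pos.ne']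
    simp [circleMap]
  have hle := enorm_integral_le_lintegral_enorm
    (μ := volume.restrict (Set.Ioc (0 : ℝ) (2 * Real.pi)))
    (fun θ : ℝ => f (Complex.exp (θ * Complex.I) • z) ^ 2)
  rw [hint, enorm_mul, enorm_pow] at hle
  simp only [enorm_pow] at hle
  rwa [← ofReal_norm, Complex.norm_real, Real.norm_of_nonneg Real.two_pi_pos.le] at hle

/-- For an open balanced set `D`, `|f(0)|² λ(D) ≤ ∫_D |f|²` for holomorphic `f`. -/
theorem enorm_sq_zero_mul_volume_le {n : ℕ} {D : Set (Fin n → ℂ)} (hD : IsOpen D)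
    (hbal : Balanced ℂ D) {f : (Fin n → ℂ) → ℂ} (hf : DifferentiableOn ℂ f D) :
    ‖f 0‖ₑ ^ 2 * volume D ≤ ∫⁻ z in D, ‖f z‖ₑ ^ 2 := by
  set F : (Fin n → ℂ) → ℝ≥0∞ := D.indicator fun z => ‖f z‖ₑ ^ 2 with hF
  have hFm : Measurable F := by
    classical
    rw [hF, ← Set.piecewise_eq_indicator]
    exact ContinuousOn.measurable_piecewise
      ((ENNReal.continuous_pow 2).comp_continuousOn hf.continuousOn.enorm)
      continuousOn_const hD.measurableSet
  have hmem : ∀ z ∈ D, ∀ w : ℂ, ‖w‖ ≤ 1 → w • z ∈ D := fun z hz w hw => hbal.smul_mem hw hz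
  have h2 : ENNReal.ofReal (2 * Real.pi) * (‖f 0‖ₑ ^ 2 * volume D) ≤
      ENNReal.ofReal (2 * Real.pi) * ∫⁻ z in D, ‖f z‖ₑ ^ 2 := by
    calc ENNReal.ofReal (2 * Real.pi) * (‖f 0‖ₑ ^ 2 * volume D)
        = ∫⁻ _ in D, ENNReal.ofReal (2 * Real.pi) * ‖f 0‖ₑ ^ 2 := by
          rw [setLIntegral_const, mul_assoc]
      _ ≤ ∫⁻ z in D, ∫⁻ θ in Set.Ioc (0 : ℝ) (2 * Real.pi),
            F (Complex.exp (θ * Complex.I) • z) := by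
          refine setLIntegral_mono' hD.measurableSet fun z hz => ?_
          refine (enorm_sq_le_lintegral_circle hD hf (hmem z hz)).trans_eq ?_
          refine lintegral_congr fun θ => ?_
          rw [hF, Set.indicator_of_mem (hmem z hz _ (Complex.norm_exp_ofReal_mul_I θ).le)]
      _ ≤ ∫⁻ z, ∫⁻ θ in Set.Ioc (0 : ℝ) (2 * Real.pi),
            F (Complex.exp (θ * Complex.I) • z) := setLIntegral_le_lintegral _ _
      _ = ∫⁻ θ in Set.Ioc (0 : ℝ) (2 * Real.pi), ∫⁻ z,
            F (Complex.exp (θ * Complex.I) • z) := by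
          refine lintegral_lintegral_swap (hFm.comp ?_).aemeasurable
          exact Continuous.measurable (by fun_prop)
      _ = ∫⁻ θ in Set.Ioc (0 : ℝ) (2 * Real.pi), ∫⁻ z in D, ‖f z‖ₑ ^ 2 := by
          refine lintegral_congr fun θ => ?_
          rw [← lintegral_indicator hD.measurableSet]
          have := (measurePreserving_circle_smul (n := n) (Circle.exp θ)).lintegral_comp hFm
          simpa only [Circle.coe_exp] using this
      _ = ENNReal.ofReal (2 * Real.pi) * ∫⁻ z in D, ‖f z‖ₑ ^ 2 := by
          rw [setLIntegral_const, Real.volume_Ioc, sub_zero, mul_comm]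
  exact (ENNReal.mul_le_mul_iff_right (by simpa using Real.pi_pos) ENNReal.ofReal_ne_top).1 h2

/-- for a pseudoconvex balanced domain of finite volume,
`K_D(0) = 1/λ(D)`. -/
theorem statement_10 (n : ℕ) (h : (Fin n → ℂ) → ℝ)
    (hpos : ∀ z, 0 ≤ h z) (husc : UpperSemicontinuous h) (hhom : AbsHomog h)
    (hpsh : LogPSH h) (hvol : volume {z : Fin n → ℂ | h z < 1} < ⊤) :
    bergmanK {z | h z < 1} 0 = (volume {z : Fin n → ℂ | h z < 1})⁻¹ := by
  have hD : IsOpen {z : Fin n → ℂ | h z < 1} := husc.isOpen_preimage 1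
  have h0 : h 0 = 0 := by simpa using hhom 0 0
  have hbal : Balanced ℂ {z : Fin n → ℂ | h z < 1} := by
    refine balanced_iff_smul_mem.2 fun {a} ha {z} hz => ?_
    rw [Set.mem_ofPred_eq, hhom]
    exact (mul_le_of_le_one_left (hpos z) ha).trans_lt hz
  have hV0 : volume {z : Fin n → ℂ | h z < 1} ≠ 0 :=
    (hD.measure_pos volume ⟨0, by simp [h0]⟩).ne'
  apply le_antisymm
  · refine iSup_le fun f => iSup_le fun hf => iSup_le fun hint => ?_
    rw [ENNReal.le_inv_iff_mul_le]
    exact (enorm_sq_zero_mul_volume_le hD hbal hf).trans hint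
  · set V := volume {z : Fin n → ℂ | h z < 1} with hV
    have hc : (‖((√(V⁻¹).toReal : ℝ) : ℂ)‖₊ : ℝ≥0∞) ^ 2 = V⁻¹ := by
      rw [← enorm_eq_nnnorm, ← ofReal_norm, Complex.norm_real,
        Real.norm_of_nonneg (Real.sqrt_nonneg _), ← ENNReal.ofReal_pow (Real.sqrt_nonneg _),
        Real.sq_sqrt ENNReal.toReal_nonneg, ENNReal.ofReal_toReal (ENNReal.inv_ne_top.2 hV0)]
    refine le_iSup_of_le (fun _ => ((√(V⁻¹).toReal : ℝ) : ℂ)) <|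
      le_iSup_of_le (differentiableOn_const _) <| le_iSup_of_le ?_ hc.ge
    simp only [hc]
    rw [setLIntegral_const, ← hV, ENNReal.inv_mul_cancel hV0 hvol.ne]
end
end
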